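/- Let W ∈ ℝ^{nd×m} be a random matrix with i.i.d. standard Gaussian N(0,1) entries, with d×m blocks W_1,…,W_n, let W^(i) be W with its i-th block replaced by 0, and let A ∈ ℝ^{d×m} be a fixed matrix. Then for any γ > 1, with probability at least 1 − 10·n^{−γ+1}, all of the following hold simultaneously: max_{1≤i≤n} ‖W_i‖ ≤ √d+√m+√(2γ log n); ‖W‖ ≤ √(nd)+√m+√(2γ log n); max_{1≤i≤n} ‖W^(i)‖ ≤ √(nd)+√m+√(2γ log n); and max_{1≤i≤n} ‖W_i A^T‖ ≤ (2√d+√(2γ log n))·‖A‖, where ‖·‖ denotes the operator norm. -/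

import Mathlib

open MeasureTheory Matrix Filter

namespace GOPP

/-- Frobenius norm of a real matrix. -/
noncomputable def frob {α β : Type*} [Fintype α] [Fintype β] (X : Matrix α β ℝ) : ℝ :=
  Real.sqrt (∑ i, ∑ j, X i j ^ 2)

/-- Euclidean norm of a vector. -/
noncomputable def vnorm {β : Type*} [Fintype β] (v : β → ℝ) : ℝ :=
  Real.sqrt (∑ j, v j ^ 2)

/-- Operator (spectral) norm: the supremum of ‖Xu‖ over unit vectors u. -/
noncomputable def opNorm {α β : Type*} [Fintype α] [Fintype β] (X : Matrix α β ℝ) : ℝ :=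
  sSup {r : ℝ | ∃ u : β → ℝ, vnorm u = 1 ∧ r = vnorm (X.mulVec u)}

/-- Smallest singular value: the infimum of ‖uᵀX‖ over unit vectors u (for a d×m matrix
with d ≤ m this is the d-th largest singular value; for square matrices it is σ_min). -/
noncomputable def sigmaMin {α β : Type*} [Fintype α] [Fintype β] (X : Matrix α β ℝ) : ℝ :=
  sInf {r : ℝ | ∃ u : α → ℝ, vnorm u = 1 ∧ r = vnorm (Matrix.vecMul u X)}

/-- Condition number κ = σ_max/σ_min. -/
noncomputable def kappa {d m : ℕ} (A : Matrix (Fin d) (Fin m) ℝ) : ℝ :=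
  opNorm A / sigmaMin A

/-- Q is an orthogonal matrix. -/
def IsOrth {d : ℕ} (Q : Matrix (Fin d) (Fin d) ℝ) : Prop :=
  Qᵀ * Q = 1 ∧ Q * Qᵀ = 1

/-- Nuclear norm, via the dual characterization ‖M‖_* = max_{Q ∈ O(d)} ⟨Q, M⟩. -/
noncomputable def nuclearNorm {d : ℕ} (M : Matrix (Fin d) (Fin d) ℝ) : ℝ :=
  sSup {r : ℝ | ∃ Q : Matrix (Fin d) (Fin d) ℝ, IsOrth Q ∧ r = Matrix.trace (Qᵀ * M)}

/-- The i-th d×k block of an (nd)×k block matrix. -/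
def blk {n d k : ℕ} (S : Matrix (Fin n × Fin d) (Fin k) ℝ) (i : Fin n) :
    Matrix (Fin d) (Fin k) ℝ :=
  Matrix.of fun a b => S (i, a) b

/-- The i-th diagonal d×d block of an (nd)×(nd) matrix. -/
def dblk {n d : ℕ} (G : Matrix (Fin n × Fin d) (Fin n × Fin d) ℝ) (i : Fin n) :
    Matrix (Fin d) (Fin d) ℝ :=
  Matrix.of fun a b => G (i, a) (i, b)

/-- S ∈ O(d)^{⊗n}: each of the n d×d blocks of S is orthogonal. -/
def OrthBlocks {n d : ℕ} (S : Matrix (Fin n × Fin d) (Fin d) ℝ) : Prop :=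
  ∀ i, IsOrth (blk S i)

/-- Z ∈ ℝ^{nd×d}: the vertical stack of n copies of I_d. -/
def ZStack (n d : ℕ) : Matrix (Fin n × Fin d) (Fin d) ℝ :=
  Matrix.of fun p j => if p.2 = j then 1 else 0

/-- Vertical stack of n given d×k matrices. -/
def stack {n d k : ℕ} (B : Fin n → Matrix (Fin d) (Fin k) ℝ) :
    Matrix (Fin n × Fin d) (Fin k) ℝ :=
  Matrix.of fun p b => B p.1 p.2 b

/-- d_F(X,Y) = min_{Q ∈ O(d)} ‖X − YQ‖_F. -/
noncomputable def dF {n d : ℕ} (X Y : Matrix (Fin n × Fin d) (Fin d) ℝ) : ℝ :=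
  sInf {r : ℝ | ∃ Q, IsOrth Q ∧ r = frob (X - Y * Q)}

/-- R is a polar factor P(X) of X: an orthogonal global minimizer of ‖X − Q‖_F over O(d). -/
def IsPolar {d : ℕ} (X R : Matrix (Fin d) (Fin d) ℝ) : Prop :=
  IsOrth R ∧ ∀ Q : Matrix (Fin d) (Fin d) ℝ, IsOrth Q → frob (X - R) ≤ frob (X - Q)

/-- S = P_n(X): blockwise polar factor. -/
def IsPolarBlocks {n d : ℕ} (X S : Matrix (Fin n × Fin d) (Fin d) ℝ) : Prop :=
  ∀ i, IsPolar (blk X i) (blk S i)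

/-- U collects (an orthonormal basis of the span of) the top d left singular vectors of D:
U has orthonormal columns and maximizes the Ky Fan quantity trace(Uᵀ(DDᵀ)U). -/
def IsTopSingVecs {N : Type*} [Fintype N] {d m : ℕ} (D : Matrix N (Fin m) ℝ)
    (U : Matrix N (Fin d) ℝ) : Prop :=
  Uᵀ * U = 1 ∧ ∀ Q : Matrix N (Fin d) ℝ, Qᵀ * Q = 1 →
    Matrix.trace (Qᵀ * (D * Dᵀ) * Q) ≤ Matrix.trace (Uᵀ * (D * Dᵀ) * U)

/-- (U, S, V) is a top-d singular triple of D: orthonormal U, V, diagonal nonnegative S,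
DV = US, DᵀU = VS, and U spans a top-d left singular subspace. -/
def IsSVDTriple {N : Type*} [Fintype N] {d m : ℕ} (D : Matrix N (Fin m) ℝ)
    (U : Matrix N (Fin d) ℝ) (S : Matrix (Fin d) (Fin d) ℝ)
    (V : Matrix (Fin m) (Fin d) ℝ) : Prop :=
  Vᵀ * V = 1 ∧ (∀ a b, a ≠ b → S a b = 0) ∧ (∀ a, 0 ≤ S a a) ∧
    D * V = U * S ∧ Dᵀ * U = V * S ∧ IsTopSingVecs D U

/-- The generalized power method sequence with spectral initialization, run on the data
matrix D (so with C = DDᵀ): S⁰ = P_n(U) for top singular vectors U of D, and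
S^{t+1} = P_n(C Sᵗ). -/
def IsGPM {n d m : ℕ} (D : Matrix (Fin n × Fin d) (Fin m) ℝ)
    (S : ℕ → Matrix (Fin n × Fin d) (Fin d) ℝ) : Prop :=
  (∃ U, IsTopSingVecs D U ∧ IsPolarBlocks U (S 0)) ∧
    ∀ t, IsPolarBlocks (D * Dᵀ * S t) (S (t + 1))

/-- W^(i): W with its i-th block row replaced by 0. -/
def mask {n d m : ℕ} (W : Matrix (Fin n × Fin d) (Fin m) ℝ) (i : Fin n) :
    Matrix (Fin n × Fin d) (Fin m) ℝ :=
  Matrix.of fun p b => if p.1 = i then 0 else W p b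

/-- The noise matrix Δ = WAᵀZᵀ + ZAWᵀ + σWWᵀ. -/
noncomputable def delta {n d m : ℕ} (A : Matrix (Fin d) (Fin m) ℝ)
    (W : Matrix (Fin n × Fin d) (Fin m) ℝ) (σ : ℝ) :
    Matrix (Fin n × Fin d) (Fin n × Fin d) ℝ :=
  W * Aᵀ * (ZStack n d)ᵀ + ZStack n d * A * Wᵀ + σ • (W * Wᵀ)

/-- The i-th block column Δ_i = WAᵀ + ZAW_iᵀ + σWW_iᵀ of Δ. -/
noncomputable def deltaCol {n d m : ℕ} (A : Matrix (Fin d) (Fin m) ℝ)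
    (W : Matrix (Fin n × Fin d) (Fin m) ℝ) (σ : ℝ) (i : Fin n) :
    Matrix (Fin n × Fin d) (Fin d) ℝ :=
  W * Aᵀ + ZStack n d * A * (blk W i)ᵀ + σ • (W * (blk W i)ᵀ)

/-- The operator L S = C S/(n‖A‖²) with C = ZAAᵀZᵀ + σΔ. -/
noncomputable def Lop {n d m : ℕ} (A : Matrix (Fin d) (Fin m) ℝ)
    (W : Matrix (Fin n × Fin d) (Fin m) ℝ) (σ : ℝ)
    (S : Matrix (Fin n × Fin d) (Fin d) ℝ) : Matrix (Fin n × Fin d) (Fin d) ℝ :=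
  ((n : ℝ) * opNorm A ^ 2)⁻¹ •
    ((ZStack n d * A * Aᵀ * (ZStack n d)ᵀ + σ • delta A W σ) * S)

/-- √(nd) + √m + √(2γ n log n). -/
noncomputable def bnd1 (n d m : ℕ) (γ : ℝ) : ℝ :=
  Real.sqrt ((n : ℝ) * d) + Real.sqrt (m : ℝ) + Real.sqrt (2 * γ * n * Real.log n)

/-- √(nd) + √m + √(2γ log n). -/
noncomputable def bnd2 (n d m : ℕ) (γ : ℝ) : ℝ :=
  Real.sqrt ((n : ℝ) * d) + Real.sqrt (m : ℝ) + Real.sqrt (2 * γ * Real.log n)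

/-- The basin of attraction N_ε. -/
def memNeps {n d : ℕ} (ε : ℝ) (S : Matrix (Fin n × Fin d) (Fin d) ℝ) : Prop :=
  OrthBlocks S ∧ dF S (ZStack n d) ≤ ε * Real.sqrt ((n : ℝ) * d)

/-- The basin of attraction N_{ξ,∞}. -/
def memNxi {n d m : ℕ} (W : Matrix (Fin n × Fin d) (Fin m) ℝ) (γ ξ : ℝ)
    (S : Matrix (Fin n × Fin d) (Fin d) ℝ) : Prop :=
  OrthBlocks S ∧ ∀ i, frob (blk W i * Wᵀ * S) ≤ ξ * Real.sqrt (d : ℝ) * bnd1 n d m γ ^ 2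

/-- The distribution of a matrix with i.i.d. standard Gaussian N(0,1) entries. -/
noncomputable def stdGaussian (ι κ : Type*) [Fintype ι] [Fintype κ] :
    Measure (ι → κ → ℝ) :=
  Measure.pi fun _ : ι => Measure.pi fun _ : κ => ProbabilityTheory.gaussianReal 0 1

section GaussianComparison

open ProbabilityTheory RealInnerProductSpace

section Slepian

variable {E : Type*} [NormedAddCommGroup E] [InnerProductSpace ℝ E] [FiniteDimensional ℝ E]
  [MeasurableSpace E] [BorelSpace E]

/-- A functional that decreases along `h` is negatively correlated with `⟪h, ·⟫` under the standard
Gaussian measure. -/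
lemma integral_inner_mul_nonpos (h : E) (H : E → ℝ)
    (hH : ∀ x, ∀ s : ℝ, 0 ≤ s → H (x + s • h) ≤ H x)
    (hint : Integrable (fun x => ⟪h, x⟫ * H x) (ProbabilityTheory.stdGaussian E)) :
    ∫ x, ⟪h, x⟫ * H x ∂(ProbabilityTheory.stdGaussian E) ≤ 0 := by
  rcases eq_or_ne h 0 with rfl | hne
  · simp
  let R := (ℝ ∙ h)ᗮ.reflection
  have hR : ∀ x, R x = x - (2 * ⟪h, x⟫ / ‖h‖ ^ 2) • h := by
    intro x
    simp only [R, Submodule.reflection_orthogonal_apply, Submodule.reflection_singleton_apply]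
    simp only [RCLike.ofReal_real_eq_id, id]
    rw [neg_sub, ← Nat.cast_smul_eq_nsmul ℝ, smul_smul]
    congr 2
    push_cast
    ring
  have hh : 0 < ‖h‖ ^ 2 := by positivity
  have hRin : ∀ x, ⟪h, R x⟫ = -⟪h, x⟫ := by
    intro x
    rw [hR, inner_sub_right, inner_smul_right, real_inner_self_eq_norm_sq]
    field_simp
    ring
  have hmp : MeasurePreserving R (ProbabilityTheory.stdGaussian E)
      (ProbabilityTheory.stdGaussian E) :=
    ⟨R.continuous.measurable, stdGaussian_map R⟩
  have hemb : MeasurableEmbedding R := R.toHomeomorph.measurableEmbedding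
  have e1 : ∫ x, ⟪h, R x⟫ * H (R x) ∂(ProbabilityTheory.stdGaussian E)
      = ∫ x, ⟪h, x⟫ * H x ∂(ProbabilityTheory.stdGaussian E) :=
    hmp.integral_comp hemb (fun x => ⟪h, x⟫ * H x)
  have hint2 : Integrable (fun x => ⟪h, R x⟫ * H (R x)) (ProbabilityTheory.stdGaussian E) :=
    (hmp.integrable_comp_emb hemb (g := fun x => ⟪h, x⟫ * H x)).2 hint
  have key : ∫ x, (⟪h, x⟫ * H x + ⟪h, R x⟫ * H (R x)) ∂(ProbabilityTheory.stdGaussian E) ≤ 0 := by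
    apply integral_nonpos
    intro x
    simp only [hRin, Pi.zero_apply]
    rcases le_total 0 ⟪h, x⟫ with hp | hp
    · have := hH (R x) (2 * ⟪h, x⟫ / ‖h‖ ^ 2) (by positivity)
      rw [hR x, sub_add_cancel, ← hR x] at this
      nlinarith
    · have := hH x (-(2 * ⟪h, x⟫ / ‖h‖ ^ 2)) (by
        rw [← neg_div]; apply div_nonneg _ hh.le; linarith)
      rw [neg_smul, ← sub_eq_add_neg, ← hR x] at this
      nlinarith
  rw [integral_add hint hint2, e1] at key
  linarith

/-- **Slepian's inequality**, smooth form: decreasing the covariances of a centered Gaussian vector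
with fixed variances decreases the expectation of a product of decreasing functions of its
coordinates. -/
lemma slepian_smooth {T : Type*} [Fintype T] [DecidableEq T] (a b : T → E)
    (hab : ∀ i j, ⟪a i, b j⟫ = 0) (hnorm : ∀ i, ‖a i‖ = ‖b i‖)
    (hcov : ∀ i j, ⟪b i, b j⟫ ≤ ⟪a i, a j⟫) {f f' : ℝ → ℝ} {C : ℝ}
    (hf : ∀ x, HasDerivAt f (f' x) x) (hfc : Continuous f') (hC : ∀ x, |f' x| ≤ C)
    (hf0 : ∀ x, 0 ≤ f x) (hf1 : ∀ x, f x ≤ 1) (hf' : ∀ x, f' x ≤ 0) :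
    ∫ x, ∏ i, f ⟪b i, x⟫ ∂(ProbabilityTheory.stdGaussian E) ≤
      ∫ x, ∏ i, f ⟪a i, x⟫ ∂(ProbabilityTheory.stdGaussian E) := by
  set μ := ProbabilityTheory.stdGaussian E with hμ
  have hfcont : Continuous f := continuous_iff_continuousAt.2 fun x => (hf x).continuousAt
  have hanti : Antitone f := antitone_of_hasDerivAt_nonpos hf hf'
  have hC0 : 0 ≤ C := (abs_nonneg _).trans (hC 0)
  let c : ℝ → T → E := fun θ i => Real.cos θ • a i + Real.sin θ • b i
  let c' : ℝ → T → E := fun θ i => -Real.sin θ • a i + Real.cos θ • b i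
  have hcin : ∀ θ i j, ⟪c' θ i, c θ j⟫ =
      Real.sin θ * Real.cos θ * (⟪b i, b j⟫ - ⟪a i, a j⟫) := by
    intro θ i j
    have hba : ⟪b i, a j⟫ = 0 := by rw [real_inner_comm]; exact hab j i
    simp only [c, c', inner_add_left, inner_add_right, inner_smul_left, inner_smul_right, hab, hba]
    simp
    ring
  have hder : ∀ θ i x, HasDerivAt (fun θ => ⟪c θ i, x⟫) ⟪c' θ i, x⟫ θ := by
    intro θ i x
    have h1 := ((Real.hasDerivAt_cos θ).mul_const ⟪a i, x⟫).add
      ((Real.hasDerivAt_sin θ).mul_const ⟪b i, x⟫)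
    simp only [c, c', inner_add_left, real_inner_smul_left]
    exact h1
  let G : ℝ → E → T → ℝ := fun θ x i =>
    ⟪c' θ i, x⟫ * (f' ⟪c θ i, x⟫ * ∏ j ∈ Finset.univ.erase i, f ⟪c θ j, x⟫)
  have hGcont : ∀ θ i, Continuous fun x => G θ x i := by
    intro θ i
    simp only [G]
    fun_prop
  have hprod : ∀ (s : Finset T) (g : T → ℝ), 0 ≤ ∏ j ∈ s, f (g j) ∧ ∏ j ∈ s, f (g j) ≤ 1 :=
    fun s g => ⟨Finset.prod_nonneg fun j _ => hf0 _,
      Finset.prod_le_one (fun j _ => hf0 _) fun j _ => hf1 _⟩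
  have hGbd : ∀ θ x i, |G θ x i| ≤ (‖a i‖ + ‖b i‖) * C * ‖x‖ := by
    intro θ x i
    simp only [G, abs_mul]
    have h1 : |⟪c' θ i, x⟫| ≤ (‖a i‖ + ‖b i‖) * ‖x‖ := by
      refine (abs_real_inner_le_norm _ _).trans ?_
      gcongr
      refine (norm_add_le _ _).trans ?_
      rw [norm_smul, norm_smul, norm_neg]
      gcongr
      · exact mul_le_of_le_one_left (norm_nonneg _) (Real.abs_sin_le_one θ)
      · exact mul_le_of_le_one_left (norm_nonneg _) (Real.abs_cos_le_one θ)
    have h2 : |f' ⟪c θ i, x⟫| * |∏ j ∈ Finset.univ.erase i, f ⟪c θ j, x⟫| ≤ C := by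
      obtain ⟨p0, p1⟩ := hprod (Finset.univ.erase i) (fun j => ⟪c θ j, x⟫)
      rw [abs_of_nonneg p0]
      calc _ ≤ C * 1 := by gcongr; exact hC _
        _ = C := mul_one _
    calc _ ≤ ((‖a i‖ + ‖b i‖) * ‖x‖) * C := by gcongr
      _ = _ := by ring
  have hnint : Integrable (fun x : E => ‖x‖) μ := (IsGaussian.integrable_id (μ := μ)).norm
  have hGint : ∀ θ i, Integrable (fun x => G θ x i) μ := by
    intro θ i
    refine (hnint.const_mul ((‖a i‖ + ‖b i‖) * C)).mono' (hGcont θ i).aestronglyMeasurable ?_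
    exact Eventually.of_forall fun x => hGbd θ x i
  have hFcont : ∀ θ, Continuous fun x => ∏ i, f ⟪c θ i, x⟫ := by
    intro θ
    fun_prop
  have hFder : ∀ θ, HasDerivAt (fun θ => ∫ x, ∏ i, f ⟪c θ i, x⟫ ∂μ) (∫ x, ∑ i, G θ x i ∂μ) θ := by
    intro θ
    refine (hasDerivAt_integral_of_dominated_loc_of_deriv_le (s := Set.univ) (μ := μ)
      (F := fun θ x => ∏ i, f ⟪c θ i, x⟫) (F' := fun θ x => ∑ i, G θ x i)
      (bound := fun x => ∑ i, (‖a i‖ + ‖b i‖) * C * ‖x‖) univ_mem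
      (Eventually.of_forall fun θ => (hFcont θ).aestronglyMeasurable) ?_ ?_ ?_ ?_ ?_).2
    · refine (integrable_const (1 : ℝ)).mono' (hFcont θ).aestronglyMeasurable ?_
      refine Eventually.of_forall fun x => ?_
      obtain ⟨p0, p1⟩ := hprod Finset.univ (fun j => ⟪c θ j, x⟫)
      rw [Real.norm_of_nonneg p0]
      exact p1
    · exact (continuous_finsetSum _ fun i _ => hGcont θ i).aestronglyMeasurable
    · refine Eventually.of_forall fun x θ _ => ?_
      exact (norm_sum_le _ _).trans (Finset.sum_le_sum fun i _ => hGbd θ x i)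
    · exact integrable_finsetSum _ fun i _ => hnint.const_mul _
    · refine Eventually.of_forall fun x θ _ => ?_
      have := HasDerivAt.fun_finsetProd (u := Finset.univ) (x := θ)
        (f := fun i θ => f ⟪c θ i, x⟫) (f' := fun i => f' ⟪c θ i, x⟫ * ⟪c' θ i, x⟫)
        (fun i _ => (hf _).comp θ (hder θ i x))
      refine this.congr_deriv (Finset.sum_congr rfl fun i _ => ?_)
      simp only [G, smul_eq_mul]
      ring
  have hneg : ∀ θ ∈ interior (Set.Icc 0 (Real.pi / 2)), ∫ x, ∑ i, G θ x i ∂μ ≤ 0 := by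
    intro θ hθ
    rw [interior_Icc] at hθ
    have hs : 0 ≤ Real.sin θ * Real.cos θ :=
      mul_nonneg (Real.sin_nonneg_of_nonneg_of_le_pi hθ.1.le (by linarith [hθ.2, Real.pi_pos]))
        (Real.cos_nonneg_of_mem_Icc ⟨by linarith [hθ.1, Real.pi_pos], hθ.2.le⟩)
    rw [integral_finsetSum _ fun i _ => hGint θ i]
    refine Finset.sum_nonpos fun i _ => ?_
    refine integral_inner_mul_nonpos (c' θ i)
      (fun x => f' ⟪c θ i, x⟫ * ∏ j ∈ Finset.univ.erase i, f ⟪c θ j, x⟫) ?_ (hGint θ i)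
    intro x s hs0
    have hii : ⟪c θ i, c' θ i⟫ = 0 := by
      rw [real_inner_comm, hcin, real_inner_self_eq_norm_sq, real_inner_self_eq_norm_sq, hnorm]
      simp
    simp only [inner_add_right, real_inner_smul_right, hii, mul_zero, add_zero]
    refine mul_le_mul_of_nonpos_left ?_ (hf' _)
    refine Finset.prod_le_prod (fun j _ => hf0 _) fun j _ => hanti ?_
    have : ⟪c θ j, c' θ i⟫ ≤ 0 := by
      rw [real_inner_comm, hcin]
      exact mul_nonpos_of_nonneg_of_nonpos hs (by linarith [hcov i j])
    nlinarith
  have hA : AntitoneOn (fun θ => ∫ x, ∏ i, f ⟪c θ i, x⟫ ∂μ) (Set.Icc 0 (Real.pi / 2)) :=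
    antitoneOn_of_hasDerivWithinAt_nonpos (convex_Icc _ _)
      (fun θ _ => (hFder θ).continuousAt.continuousWithinAt)
      (fun θ _ => (hFder θ).hasDerivWithinAt) hneg
  have hpi : (0 : ℝ) ≤ Real.pi / 2 := by positivity
  have := hA (Set.left_mem_Icc.2 hpi) (Set.right_mem_Icc.2 hpi) hpi
  simpa [c] using this

end Slepian

section SlepianTail

lemma exists_abs_deriv_smoothTransition_le : ∃ C, ∀ x, |deriv Real.smoothTransition x| ≤ C := by
  have hc : Continuous (deriv Real.smoothTransition) :=
    (Real.smoothTransition.contDiff (n := 1)).continuous_deriv le_rfl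
  obtain ⟨C, hC⟩ := (isCompact_Icc (a := (0 : ℝ)) (b := 1)).exists_bound_of_continuousOn
    hc.continuousOn
  have hC0 : 0 ≤ C := (norm_nonneg _).trans (hC 0 (by simp))
  refine ⟨C, fun x => ?_⟩
  rcases lt_or_ge x 0 with h | h
  · have : Real.smoothTransition =ᶠ[nhds x] fun _ => 0 := by
      filter_upwards [Iio_mem_nhds h] with y hy
      exact Real.smoothTransition.zero_of_nonpos (le_of_lt hy)
    rw [this.deriv_eq]
    simpa using hC0
  rcases lt_or_ge 1 x with h' | h'
  · have : Real.smoothTransition =ᶠ[nhds x] fun _ => 1 := by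
      filter_upwards [Ioi_mem_nhds h'] with y hy
      exact Real.smoothTransition.one_of_one_le (le_of_lt hy)
    rw [this.deriv_eq]
    simpa using hC0
  · exact hC x ⟨h, h'⟩

/-- **Slepian's inequality** for the tails of the maximum of two finite Gaussian families. -/
lemma slepian_tail_inner {E : Type*} [NormedAddCommGroup E] [InnerProductSpace ℝ E]
    [FiniteDimensional ℝ E] [MeasurableSpace E] [BorelSpace E] {T : Type*} [Finite T] (a b : T → E)
    (hab : ∀ i j, ⟪a i, b j⟫ = 0) (hnorm : ∀ i, ‖a i‖ = ‖b i‖)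
    (hcov : ∀ i j, ⟪b i, b j⟫ ≤ ⟪a i, a j⟫) {r r' : ℝ} (hr : r < r') :
    ProbabilityTheory.stdGaussian E {x | ∃ i, r' ≤ ⟪a i, x⟫} ≤
      ProbabilityTheory.stdGaussian E {x | ∃ i, r < ⟪b i, x⟫} := by
  classical
  have := Fintype.ofFinite T
  set μ := ProbabilityTheory.stdGaussian E with hμ
  have hd : 0 < r' - r := sub_pos.2 hr
  obtain ⟨C, hC⟩ := exists_abs_deriv_smoothTransition_le
  let f : ℝ → ℝ := fun x => Real.smoothTransition ((r' - x) / (r' - r))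
  let f' : ℝ → ℝ := fun x => deriv Real.smoothTransition ((r' - x) / (r' - r)) * (-1 / (r' - r))
  have hfd : ∀ x, HasDerivAt f (f' x) x := by
    intro x
    have h1 : HasDerivAt Real.smoothTransition
        (deriv Real.smoothTransition ((r' - x) / (r' - r))) ((r' - x) / (r' - r)) :=
      ((Real.smoothTransition.contDiff (n := 1)).differentiable one_ne_zero _).hasDerivAt
    exact h1.comp x (((hasDerivAt_id x).const_sub r').div_const (r' - r))
  have hf'c : Continuous f' := by
    have hc : Continuous (deriv Real.smoothTransition) :=
      (Real.smoothTransition.contDiff (n := 1)).continuous_deriv le_rfl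
    simp only [f']
    fun_prop
  have hf'b : ∀ x, |f' x| ≤ C * |-1 / (r' - r)| := by
    intro x
    simp only [f', abs_mul]
    gcongr
    exact hC _
  have hf'n : ∀ x, f' x ≤ 0 := by
    intro x
    refine mul_nonpos_of_nonneg_of_nonpos Real.smoothTransition.monotone.deriv_nonneg ?_
    rw [neg_div]
    exact neg_nonpos.2 (by positivity)
  have hf0 : ∀ x, 0 ≤ f x := fun x => Real.smoothTransition.nonneg _
  have hf1 : ∀ x, f x ≤ 1 := fun x => Real.smoothTransition.le_one _
  have hfc : Continuous f := continuous_iff_continuousAt.2 fun x => (hfd x).continuousAt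
  have key := slepian_smooth a b hab hnorm hcov hfd hf'c hf'b hf0 hf1 hf'n
  have hint : ∀ c : T → E, Integrable (fun x => ∏ i, f ⟪c i, x⟫) μ := by
    intro c
    have hcont : Continuous fun x => ∏ i, f ⟪c i, x⟫ := by fun_prop
    refine (integrable_const (1 : ℝ)).mono' hcont.aestronglyMeasurable ?_
    refine Eventually.of_forall fun x => ?_
    rw [Real.norm_of_nonneg (Finset.prod_nonneg fun i _ => hf0 _)]
    exact Finset.prod_le_one (fun j _ => hf0 _) fun j _ => hf1 _
  have mA : MeasurableSet {x | ∃ i, r' ≤ ⟪a i, x⟫} := by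
    rw [Set.ofPred_exists]
    exact MeasurableSet.iUnion fun i => measurableSet_le measurable_const (by fun_prop)
  have mB : MeasurableSet {x | ∃ i, r < ⟪b i, x⟫} := by
    rw [Set.ofPred_exists]
    exact MeasurableSet.iUnion fun i => measurableSet_lt measurable_const (by fun_prop)
  have hA : μ.real {x | ∃ i, r' ≤ ⟪a i, x⟫} ≤ ∫ x, (1 - ∏ i, f ⟪a i, x⟫) ∂μ := by
    rw [← integral_indicator_one mA]
    refine integral_mono ((integrable_const (1 : ℝ)).indicator mA)
      ((integrable_const 1).sub (hint a)) fun x => ?_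
    by_cases hx : x ∈ {x | ∃ i, r' ≤ ⟪a i, x⟫}
    · obtain ⟨i, hi⟩ := id hx
      rw [Set.indicator_of_mem hx, Finset.prod_eq_zero (Finset.mem_univ i)]
      · simp
      · exact Real.smoothTransition.zero_of_nonpos
          (div_nonpos_of_nonpos_of_nonneg (by linarith) hd.le)
    · rw [Set.indicator_of_notMem hx]
      exact sub_nonneg.2 (Finset.prod_le_one (fun j _ => hf0 _) fun j _ => hf1 _)
  have hB : ∫ x, (1 - ∏ i, f ⟪b i, x⟫) ∂μ ≤ μ.real {x | ∃ i, r < ⟪b i, x⟫} := by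
    rw [← integral_indicator_one mB]
    refine integral_mono ((integrable_const 1).sub (hint b))
      ((integrable_const (1 : ℝ)).indicator mB) fun x => ?_
    by_cases hx : x ∈ {x | ∃ i, r < ⟪b i, x⟫}
    · rw [Set.indicator_of_mem hx]
      exact sub_le_self _ (Finset.prod_nonneg fun i _ => hf0 _)
    · rw [Set.indicator_of_notMem hx, Finset.prod_eq_one]
      · simp
      · intro i _
        have hi : ⟪b i, x⟫ ≤ r := not_lt.1 fun h => hx ⟨i, h⟩
        refine Real.smoothTransition.one_of_one_le ?_
        rw [one_le_div hd]
        linarith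
  have hle : μ.real {x | ∃ i, r' ≤ ⟪a i, x⟫} ≤ μ.real {x | ∃ i, r < ⟪b i, x⟫} := by
    refine hA.trans (le_trans ?_ hB)
    rw [integral_sub (integrable_const _) (hint a), integral_sub (integrable_const _) (hint b)]
    linarith
  exact (ENNReal.toReal_le_toReal (measure_ne_top _ _) (measure_ne_top _ _)).1 hle

/-- The distribution of a vector with i.i.d. standard Gaussian coordinates. -/
noncomputable abbrev gaussianVec (K : Type*) [Fintype K] : Measure (K → ℝ) :=
  Measure.pi fun _ : K => gaussianReal 0 1

lemma measurePreserving_ofLp_stdGaussian (K : Type*) [Fintype K] :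
    MeasurePreserving (WithLp.ofLp : EuclideanSpace ℝ K → K → ℝ)
      (ProbabilityTheory.stdGaussian (EuclideanSpace ℝ K)) (gaussianVec K) := by
  refine ⟨by fun_prop, ?_⟩
  rw [← map_pi_eq_stdGaussian, Measure.map_map (by fun_prop) (by fun_prop)]
  exact Measure.map_id

lemma measurable_dotProduct_right {K : Type*} [Fintype K] (a : K → ℝ) :
    Measurable fun x : K → ℝ => a ⬝ᵥ x := by
  unfold dotProduct
  fun_prop

/-- **Slepian's inequality** for Gaussian families given by coefficient vectors. -/
lemma slepian_tail {K L T : Type*} [Fintype K] [Fintype L] [Finite T] (a : T → K → ℝ)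
    (b : T → L → ℝ) (hnorm : ∀ i, a i ⬝ᵥ a i = b i ⬝ᵥ b i)
    (hcov : ∀ i j, b i ⬝ᵥ b j ≤ a i ⬝ᵥ a j) {r r' : ℝ} (hr : r < r') :
    gaussianVec K {x | ∃ i, r' ≤ a i ⬝ᵥ x} ≤ gaussianVec L {x | ∃ i, r < b i ⬝ᵥ x} := by
  let A : T → EuclideanSpace ℝ (K ⊕ L) := fun i => WithLp.toLp 2 (Sum.elim (a i) 0)
  let B : T → EuclideanSpace ℝ (K ⊕ L) := fun i => WithLp.toLp 2 (Sum.elim 0 (b i))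
  have hin : ∀ x y : K ⊕ L → ℝ,
      ⟪(WithLp.toLp 2 x : EuclideanSpace ℝ (K ⊕ L)), WithLp.toLp 2 y⟫ = x ⬝ᵥ y := by
    intro x y
    rw [EuclideanSpace.inner_toLp_toLp, star_trivial, dotProduct_comm]
  have hA : ∀ i j, ⟪A i, A j⟫ = a i ⬝ᵥ a j := fun i j => by simp [A, hin]
  have hB : ∀ i j, ⟪B i, B j⟫ = b i ⬝ᵥ b j := fun i j => by simp [B, hin]
  have hAB : ∀ i j, ⟪A i, B j⟫ = 0 := fun i j => by simp [A, B, hin]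
  have key := slepian_tail_inner A B hAB
    (fun i => by
      rw [← sq_eq_sq₀ (norm_nonneg _) (norm_nonneg _), ← real_inner_self_eq_norm_sq,
        ← real_inner_self_eq_norm_sq, hA, hB, hnorm])
    (fun i j => by rw [hA, hB]; exact hcov i j) hr
  have h1 := (measurePreserving_sumPiEquivProdPi
    (fun _ : K ⊕ L => gaussianReal 0 1)).comp (measurePreserving_ofLp_stdGaussian (K ⊕ L))
  have hK := measurePreserving_fst.comp h1
  have hL := measurePreserving_snd.comp h1
  have mA : MeasurableSet {x | ∃ i, r' ≤ a i ⬝ᵥ x} := by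
    rw [Set.ofPred_exists]
    exact MeasurableSet.iUnion fun i => measurableSet_le measurable_const
      (measurable_dotProduct_right _)
  have mB : MeasurableSet {x | ∃ i, r < b i ⬝ᵥ x} := by
    rw [Set.ofPred_exists]
    exact MeasurableSet.iUnion fun i => measurableSet_lt measurable_const
      (measurable_dotProduct_right _)
  rw [← hK.measure_preimage mA.nullMeasurableSet, ← hL.measure_preimage mB.nullMeasurableSet]
  refine le_trans (le_of_eq ?_) (key.trans (le_of_eq ?_)) <;> congr 1
  · ext x
    have : ∀ i, ⟪A i, x⟫ = a i ⬝ᵥ fun k => x (Sum.inl k) := fun i => by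
      rw [← WithLp.toLp_ofLp 2 x, hin]
      simp [dotProduct, Fintype.sum_sum_type]
    simp only [Set.mem_preimage, Set.mem_ofPred_eq, this]
    rfl
  · ext x
    have : ∀ i, ⟪B i, x⟫ = b i ⬝ᵥ fun k => x (Sum.inr k) := fun i => by
      rw [← WithLp.toLp_ofLp 2 x, hin]
      simp [dotProduct, Fintype.sum_sum_type]
    simp only [Set.mem_preimage, Set.mem_ofPred_eq, this]
    rfl

end SlepianTail

section ChiMGF

lemma lintegral_exp_sq_gaussianReal {y : ℝ} (hy : 0 < y) :
    ∫⁻ x, ENNReal.ofReal (Real.exp ((1 - 1 / y ^ 2) / 2 * x ^ 2)) ∂(gaussianReal 0 1) =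
      ENNReal.ofReal y := by
  rw [gaussianReal_of_var_ne_zero 0 one_ne_zero,
    lintegral_withDensity_eq_lintegral_mul _ (by fun_prop) (by fun_prop)]
  have hb : 0 < 1 / (2 * y ^ 2) := by positivity
  have h1 : ∀ x : ℝ, (gaussianPDF 0 1 * fun x => ENNReal.ofReal
      (Real.exp ((1 - 1 / y ^ 2) / 2 * x ^ 2))) x =
      ENNReal.ofReal ((√(2 * Real.pi))⁻¹ * Real.exp (-(1 / (2 * y ^ 2)) * x ^ 2)) := by
    intro x
    rw [Pi.mul_apply, gaussianPDF, ← ENNReal.ofReal_mul (gaussianPDFReal_nonneg _ _ _),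
      gaussianPDFReal]
    congr 1
    simp only [NNReal.coe_one, mul_one, sub_zero]
    rw [mul_assoc, ← Real.exp_add]
    congr 2
    field_simp
    ring
  simp_rw [h1]
  rw [← ofReal_integral_eq_lintegral_ofReal ((integrable_exp_neg_mul_sq hb).const_mul _)
    (Eventually.of_forall fun x => by positivity), integral_const_mul, integral_gaussian]
  congr 1
  have : Real.pi / (1 / (2 * y ^ 2)) = (2 * Real.pi) * y ^ 2 := by field_simp
  rw [this, Real.sqrt_mul (by positivity) (y ^ 2), Real.sqrt_sq hy.le]
  have : √(2 * Real.pi) ≠ 0 := by positivity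
  field_simp

lemma lintegral_exp_mul_gaussianReal (c : ℝ) :
    ∫⁻ x, ENNReal.ofReal (Real.exp (c * x)) ∂(gaussianReal 0 1) =
      ENNReal.ofReal (Real.exp (c ^ 2 / 2)) := by
  rw [← ofReal_integral_eq_lintegral_ofReal (integrable_exp_mul_gaussianReal c)
    (Eventually.of_forall fun x => by positivity)]
  have := congrFun (mgf_id_gaussianReal (μ := 0) (v := 1)) c
  simp only [mgf, id] at this
  rw [this]
  simp

/-- The Euclidean norm of a standard Gaussian vector in dimension `p` has moment generating function
at most that of `N(√p, 1)`. -/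
lemma lintegral_exp_sqrt_gaussianVec_le {P : Type*} [Fintype P] [Nonempty P] {c : ℝ} (hc : 0 ≤ c) :
    ∫⁻ x, ENNReal.ofReal (Real.exp (c * √(x ⬝ᵥ x))) ∂(gaussianVec P) ≤
      ENNReal.ofReal (Real.exp (c * √(Fintype.card P : ℝ) + c ^ 2 / 2)) := by
  set p : ℝ := (Fintype.card P : ℝ) with hp
  have hp0 : 0 < p := by rw [hp]; exact_mod_cast Fintype.card_pos
  set q := √p with hq
  have hq0 : 0 < q := Real.sqrt_pos.2 hp0
  have hqq : q ^ 2 = p := Real.sq_sqrt hp0.le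
  obtain ⟨y, hy1, hyc⟩ : ∃ y : ℝ, 1 ≤ y ∧ c = q * (y - 1 / y) := by
    have hs := Real.sq_sqrt (show 0 ≤ (c / q) ^ 2 + 4 by positivity)
    have hs2 : 2 ≤ √((c / q) ^ 2 + 4) := Real.le_sqrt_of_sq_le (by nlinarith [sq_nonneg (c / q)])
    have hx : 0 ≤ c / q := by positivity
    refine ⟨(c / q + √((c / q) ^ 2 + 4)) / 2, by linarith, ?_⟩
    set z := √((c / q) ^ 2 + 4)
    have hne : c / q + z ≠ 0 := by positivity
    have : (c / q + z) / 2 - 1 / ((c / q + z) / 2) = c / q := by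
      field_simp
      field_simp at hs
      nlinarith
    rw [this]
    field_simp
  have hy0 : 0 < y := by linarith
  have hpt : ∀ x : P → ℝ, Real.exp (c * √(x ⬝ᵥ x)) ≤
      Real.exp (p * (y ^ 2 - 1) / 2) * ∏ i, Real.exp ((1 - 1 / y ^ 2) / 2 * x i ^ 2) := by
    intro x
    rw [← Real.exp_sum, ← Real.exp_add, Real.exp_le_exp, ← Finset.mul_sum]
    have hxx : ∑ i, x i ^ 2 = √(x ⬝ᵥ x) ^ 2 := by
      have h0 : 0 ≤ x ⬝ᵥ x := Finset.sum_nonneg fun i _ => mul_self_nonneg _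
      rw [Real.sq_sqrt h0]
      simp [dotProduct, sq]
    rw [hxx, hyc, ← hqq]
    set R := √(x ⬝ᵥ x)
    have h2 : 0 ≤ (y ^ 2 - 1) / 2 * (R / y - q) ^ 2 :=
      mul_nonneg (by nlinarith) (sq_nonneg _)
    have h3 : q ^ 2 * (y ^ 2 - 1) / 2 + (1 - 1 / y ^ 2) / 2 * R ^ 2 - q * (y - 1 / y) * R =
        (y ^ 2 - 1) / 2 * (R / y - q) ^ 2 := by
      field_simp
      ring
    linarith
  have hind : iIndepFun (fun (i : P) (x : P → ℝ) =>
      ENNReal.ofReal (Real.exp ((1 - 1 / y ^ 2) / 2 * x i ^ 2))) (gaussianVec P) :=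
    iIndepFun_pi (μ := fun _ : P => gaussianReal 0 1) (X := fun _ t =>
      ENNReal.ofReal (Real.exp ((1 - 1 / y ^ 2) / 2 * t ^ 2))) fun _ => by fun_prop
  have hprod : ∫⁻ x, ∏ i, ENNReal.ofReal (Real.exp ((1 - 1 / y ^ 2) / 2 * x i ^ 2))
      ∂(gaussianVec P) = ENNReal.ofReal y ^ Fintype.card P := by
    rw [lintegral_prod_eq_prod_lintegral_of_indepFun _ _ hind fun _ => by fun_prop]
    rw [← Finset.card_univ, ← Finset.prod_const]
    refine Finset.prod_congr rfl fun i _ => ?_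
    rw [← lintegral_exp_sq_gaussianReal hy0]
    exact (measurePreserving_eval (fun _ : P => gaussianReal 0 1) i).lintegral_comp
      (f := fun t => ENNReal.ofReal (Real.exp ((1 - 1 / y ^ 2) / 2 * t ^ 2))) (by fun_prop)
  calc ∫⁻ x, ENNReal.ofReal (Real.exp (c * √(x ⬝ᵥ x))) ∂(gaussianVec P)
      ≤ ∫⁻ x, ENNReal.ofReal (Real.exp (p * (y ^ 2 - 1) / 2)) *
          ∏ i, ENNReal.ofReal (Real.exp ((1 - 1 / y ^ 2) / 2 * x i ^ 2)) ∂(gaussianVec P) := by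
        refine lintegral_mono fun x => ?_
        rw [← ENNReal.ofReal_prod_of_nonneg fun _ _ => (Real.exp_pos _).le,
          ← ENNReal.ofReal_mul (Real.exp_pos _).le]
        exact ENNReal.ofReal_le_ofReal (hpt x)
    _ = ENNReal.ofReal (Real.exp (p * (y ^ 2 - 1) / 2) * y ^ Fintype.card P) := by
        rw [lintegral_const_mul _ (by fun_prop), hprod, ← ENNReal.ofReal_pow hy0.le,
          ← ENNReal.ofReal_mul (Real.exp_pos _).le]
    _ ≤ _ := by
        apply ENNReal.ofReal_le_ofReal
        have hyexp : y ≤ Real.exp (y - 1) := by linarith [Real.add_one_le_exp (y - 1)]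
        calc Real.exp (p * (y ^ 2 - 1) / 2) * y ^ Fintype.card P
            ≤ Real.exp (p * (y ^ 2 - 1) / 2) * Real.exp (y - 1) ^ Fintype.card P := by gcongr
          _ = Real.exp (p * (y ^ 2 - 1) / 2 + p * (y - 1)) := by
              rw [← Real.exp_nat_mul, ← Real.exp_add]
          _ ≤ _ := by
              rw [Real.exp_le_exp, hyc, ← hqq]
              have h3 : q * (y - 1 / y) * q + (q * (y - 1 / y)) ^ 2 / 2 -
                  (q ^ 2 * (y ^ 2 - 1) / 2 + q ^ 2 * (y - 1)) = q ^ 2 / 2 * (1 - 1 / y) ^ 2 := by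
                field_simp
                ring
              have : 0 ≤ q ^ 2 / 2 * (1 - 1 / y) ^ 2 := by positivity
              linarith

end ChiMGF

section Chevet

lemma lintegral_gaussianVec_sum_mul {K L : Type*} [Fintype K] [Fintype L] {f : (K → ℝ) → ENNReal}
    {g : (L → ℝ) → ENNReal} (hf : Measurable f) (hg : Measurable g) :
    ∫⁻ z, f (fun k => z (Sum.inl k)) * g (fun l => z (Sum.inr l)) ∂(gaussianVec (K ⊕ L)) =
      (∫⁻ x, f x ∂(gaussianVec K)) * ∫⁻ y, g y ∂(gaussianVec L) := by
  rw [← lintegral_prod_mul hf.aemeasurable hg.aemeasurable]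
  exact (measurePreserving_sumPiEquivProdPi (fun _ : K ⊕ L => gaussianReal 0 1)).lintegral_comp
    (f := fun z => f z.1 * g z.2) (by fun_prop)

lemma dotProduct_le_sqrt_of_unit {K : Type*} [Fintype K] {u : K → ℝ} (hu : u ⬝ᵥ u = 1)
    (x : K → ℝ) : u ⬝ᵥ x ≤ √(x ⬝ᵥ x) := by
  refine Real.le_sqrt_of_sq_le ?_
  have := Finset.sum_mul_sq_le_sq_mul_sq Finset.univ u x
  have h1 : ∑ i, u i ^ 2 = 1 := by rw [← hu]; simp [dotProduct, sq]
  rw [h1, one_mul] at this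
  refine this.trans (le_of_eq ?_)
  simp [dotProduct, sq]

lemma dotProduct_le_one_of_unit {K : Type*} [Fintype K] {u v : K → ℝ} (hu : u ⬝ᵥ u = 1)
    (hv : v ⬝ᵥ v = 1) : u ⬝ᵥ v ≤ 1 := by
  simpa [hv] using dotProduct_le_sqrt_of_unit hu v

lemma measurable_sqrt_dotProduct_self {K : Type*} [Fintype K] :
    Measurable fun x : K → ℝ => √(x ⬝ᵥ x) := by
  unfold dotProduct
  fun_prop

lemma measurable_ofReal_exp_mul_sqrt {K : Type*} [Fintype K] (t : ℝ) :
    Measurable fun x : K → ℝ => ENNReal.ofReal (Real.exp (t * √(x ⬝ᵥ x))) :=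
  (measurable_sqrt_dotProduct_self.const_mul t).exp.ennreal_ofReal

/-- Sub-Gaussian tail, centered at Chevet's bound, for the maximum of finitely many Gaussians whose
covariances are products of inner products of unit vectors. -/
lemma chevet_tail {K P R T : Type*} [Fintype K] [Fintype P] [Fintype R] [Finite T] [Nonempty P]
    [Nonempty R] (a : T → K → ℝ) (u : T → P → ℝ) (w : T → R → ℝ) (hu : ∀ i, u i ⬝ᵥ u i = 1)
    (hw : ∀ i, w i ⬝ᵥ w i = 1) (ha : ∀ i j, a i ⬝ᵥ a j = (u i ⬝ᵥ u j) * (w i ⬝ᵥ w j))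
    {t : ℝ} (ht : 0 < t) :
    gaussianVec K {x | ∃ i, √(Fintype.card P : ℝ) + √(Fintype.card R : ℝ) + t ≤ a i ⬝ᵥ x} ≤
      ENNReal.ofReal (Real.exp (-(t ^ 2 / 2))) := by
  set p := √(Fintype.card P : ℝ)
  set q := √(Fintype.card R : ℝ)
  set s := p + q + t with hs
  set S := {x | ∃ i, s ≤ a i ⬝ᵥ x} with hS
  have hSm : MeasurableSet S := by
    rw [hS, Set.ofPred_exists]
    exact MeasurableSet.iUnion fun i => measurableSet_le measurable_const
      (measurable_dotProduct_right _)
  let N : (P ⊕ R → ℝ) → ℝ := fun y =>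
    √((fun k => y (Sum.inl k)) ⬝ᵥ fun k => y (Sum.inl k)) +
      √((fun k => y (Sum.inr k)) ⬝ᵥ fun k => y (Sum.inr k))
  have hNm : Measurable N := by
    simp only [N]
    exact (measurable_sqrt_dotProduct_self.comp (by fun_prop)).add
      (measurable_sqrt_dotProduct_self.comp (by fun_prop))
  let F : (K ⊕ Unit → ℝ) → ℝ := Set.indicator {z | (fun k => z (Sum.inl k)) ∈ S}
    fun z => Real.exp (t * (s + z (Sum.inr ())))
  have hSm' : MeasurableSet {z : K ⊕ Unit → ℝ | (fun k => z (Sum.inl k)) ∈ S} :=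
    hSm.preimage (f := fun (z : K ⊕ Unit → ℝ) k => z (Sum.inl k)) (by fun_prop)
  have hFm : Measurable F := Measurable.indicator (by fun_prop) hSm'
  have hF0 : ∀ z, 0 ≤ F z := Set.indicator_nonneg fun z _ => (Real.exp_pos _).le
  have hFmem : ∀ z : K ⊕ Unit → ℝ, (fun k => z (Sum.inl k)) ∈ S →
      F z = Real.exp (t * (s + z (Sum.inr ()))) := fun z hz =>
    Set.indicator_of_mem (s := {z : K ⊕ Unit → ℝ | (fun k => z (Sum.inl k)) ∈ S}) hz _
  have hFnotMem : ∀ z : K ⊕ Unit → ℝ, (fun k => z (Sum.inl k)) ∉ S → F z = 0 := fun z hz =>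
    Set.indicator_of_notMem (s := {z : K ⊕ Unit → ℝ | (fun k => z (Sum.inl k)) ∈ S}) hz _
  have hcmp : ∀ ε > 0, ∫⁻ z, ENNReal.ofReal (F z) ∂(gaussianVec (K ⊕ Unit)) ≤
      ∫⁻ y, ENNReal.ofReal (Real.exp (t * (N y + ε))) ∂(gaussianVec (P ⊕ R)) := by
    intro ε hε
    rw [lintegral_eq_lintegral_meas_le _ (Eventually.of_forall hF0) hFm.aemeasurable,
      lintegral_eq_lintegral_meas_le _ (Eventually.of_forall fun y => (Real.exp_pos _).le)
        (by fun_prop)]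
    refine setLIntegral_mono_ae' measurableSet_Ioi (Eventually.of_forall fun τ hτ => ?_)
    have hτ0 : (0 : ℝ) < τ := hτ
    have key := slepian_tail (fun i => Sum.elim (a i) (1 : Unit → ℝ))
      (fun i => Sum.elim (u i) (w i)) (r' := Real.log τ / t) (r := Real.log τ / t - ε)
      (fun i => by simp [ha, hu, hw])
      (fun i j => by
        simp only [sumElim_dotProduct_sumElim, ha]
        have h1 := dotProduct_le_one_of_unit (hu i) (hu j)
        have h2 := dotProduct_le_one_of_unit (hw i) (hw j)
        have h3 : (1 : Unit → ℝ) ⬝ᵥ 1 = 1 := by simp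
        rw [h3]
        nlinarith)
      (by linarith)
    refine le_trans (measure_mono ?_) (key.trans (measure_mono ?_))
    · intro z hz
      have hz' : τ ≤ F z := hz
      by_cases hm : (fun k => z (Sum.inl k)) ∈ S
      · obtain ⟨i, hi⟩ := id hm
        rw [hFmem z hm, ← Real.log_le_iff_le_exp hτ0] at hz'
        refine ⟨i, ?_⟩
        have e : Sum.elim (a i) (1 : Unit → ℝ) ⬝ᵥ z =
            a i ⬝ᵥ (fun k => z (Sum.inl k)) + z (Sum.inr ()) := by
          simp [dotProduct, Fintype.sum_sum_type]
        rw [e, div_le_iff₀ ht]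
        nlinarith
      · have := hFnotMem z hm
        linarith
    · rintro y ⟨i, hi⟩
      have e : Sum.elim (u i) (w i) ⬝ᵥ y =
          u i ⬝ᵥ (fun k => y (Sum.inl k)) + w i ⬝ᵥ (fun k => y (Sum.inr k)) := by
        simp [dotProduct, Fintype.sum_sum_type]
      rw [e] at hi
      have h1 := dotProduct_le_sqrt_of_unit (hu i) (fun k => y (Sum.inl k))
      have h2 := dotProduct_le_sqrt_of_unit (hw i) (fun k => y (Sum.inr k))
      have h3 : Real.log τ / t < N y + ε := by simp only [N]; linarith
      rw [div_lt_iff₀ ht] at h3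
      change τ ≤ Real.exp (t * (N y + ε))
      rw [← Real.log_le_iff_le_exp hτ0]
      linarith
  have hL : ∫⁻ z, ENNReal.ofReal (F z) ∂(gaussianVec (K ⊕ Unit)) =
      gaussianVec K S * ENNReal.ofReal (Real.exp (t * s + t ^ 2 / 2)) := by
    have h1 : ∀ z, ENNReal.ofReal (F z) =
        S.indicator (fun _ => ENNReal.ofReal (Real.exp (t * s))) (fun k => z (Sum.inl k)) *
          ENNReal.ofReal (Real.exp (t * z (Sum.inr ()))) := by
      intro z
      by_cases hm : (fun k => z (Sum.inl k)) ∈ S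
      · rw [hFmem z hm, Set.indicator_of_mem hm, ← ENNReal.ofReal_mul (Real.exp_pos _).le,
          ← Real.exp_add, mul_add]
      · rw [hFnotMem z hm, Set.indicator_of_notMem hm]
        simp
    simp_rw [h1]
    rw [lintegral_gaussianVec_sum_mul (measurable_const.indicator hSm)
        (g := fun v => ENNReal.ofReal (Real.exp (t * v ()))) (by fun_prop),
      lintegral_indicator_const hSm,
      (measurePreserving_eval (fun _ : Unit => gaussianReal 0 1) ()).lintegral_comp
        (f := fun x => ENNReal.ofReal (Real.exp (t * x))) (by fun_prop),
      lintegral_exp_mul_gaussianReal, Real.exp_add, ENNReal.ofReal_mul (Real.exp_pos _).le]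
    ring
  have hR : ∀ ε, ∫⁻ y, ENNReal.ofReal (Real.exp (t * (N y + ε))) ∂(gaussianVec (P ⊕ R)) ≤
      ENNReal.ofReal (Real.exp (t * p + t * q + t ^ 2 + t * ε)) := by
    intro ε
    have h1 : ∀ y, ENNReal.ofReal (Real.exp (t * (N y + ε))) =
        (ENNReal.ofReal (Real.exp (t * ε)) * ENNReal.ofReal (Real.exp
          (t * √((fun k => y (Sum.inl k)) ⬝ᵥ fun k => y (Sum.inl k))))) *
        ENNReal.ofReal (Real.exp
          (t * √((fun k => y (Sum.inr k)) ⬝ᵥ fun k => y (Sum.inr k)))) := by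
      intro y
      rw [← ENNReal.ofReal_mul (Real.exp_pos _).le, ← Real.exp_add,
        ← ENNReal.ofReal_mul (Real.exp_pos _).le, ← Real.exp_add]
      congr 2
      simp only [N]
      ring
    simp_rw [h1]
    rw [lintegral_gaussianVec_sum_mul (f := fun x => ENNReal.ofReal (Real.exp (t * ε)) *
        ENNReal.ofReal (Real.exp (t * √(x ⬝ᵥ x))))
        (g := fun x => ENNReal.ofReal (Real.exp (t * √(x ⬝ᵥ x))))
        ((measurable_ofReal_exp_mul_sqrt t).const_mul _) (measurable_ofReal_exp_mul_sqrt t),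
      lintegral_const_mul _ (measurable_ofReal_exp_mul_sqrt t)]
    calc _ ≤ (ENNReal.ofReal (Real.exp (t * ε)) *
          ENNReal.ofReal (Real.exp (t * p + t ^ 2 / 2))) *
          ENNReal.ofReal (Real.exp (t * q + t ^ 2 / 2)) := by
          gcongr
          · exact lintegral_exp_sqrt_gaussianVec_le ht.le
          · exact lintegral_exp_sqrt_gaussianVec_le ht.le
      _ = _ := by
          rw [← ENNReal.ofReal_mul (Real.exp_pos _).le, ← Real.exp_add,
            ← ENNReal.ofReal_mul (Real.exp_pos _).le, ← Real.exp_add]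
          congr 2
          ring
  have hε : ∀ ε > 0, gaussianVec K S ≤ ENNReal.ofReal (Real.exp (t * ε - t ^ 2 / 2)) := by
    intro ε hε
    have h1 := (hL.symm.le.trans (hcmp ε hε)).trans (hR ε)
    calc gaussianVec K S = gaussianVec K S * ENNReal.ofReal (Real.exp (t * s + t ^ 2 / 2)) *
          ENNReal.ofReal (Real.exp (-(t * s + t ^ 2 / 2))) := by
          rw [mul_assoc, ← ENNReal.ofReal_mul (Real.exp_pos _).le, ← Real.exp_add]
          simp
      _ ≤ ENNReal.ofReal (Real.exp (t * p + t * q + t ^ 2 + t * ε)) *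
          ENNReal.ofReal (Real.exp (-(t * s + t ^ 2 / 2))) := by gcongr
      _ = _ := by
          rw [← ENNReal.ofReal_mul (Real.exp_pos _).le, ← Real.exp_add, hs]
          congr 2
          ring
  have hcont : Continuous fun ε : ℝ => ENNReal.ofReal (Real.exp (t * ε - t ^ 2 / 2)) :=
    ENNReal.continuous_ofReal.comp (by fun_prop)
  have hlim : Tendsto (fun ε : ℝ => ENNReal.ofReal (Real.exp (t * ε - t ^ 2 / 2)))
      (nhdsWithin 0 (Set.Ioi 0)) (nhds (ENNReal.ofReal (Real.exp (-(t ^ 2 / 2))))) := by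
    have := hcont.tendsto 0
    simp only [mul_zero, zero_sub] at this
    exact this.mono_left nhdsWithin_le_nhds
  exact ge_of_tendsto hlim (eventually_mem_nhdsWithin.mono hε)

end Chevet

section ChevetSup

/-- The tail bound `chevet_tail` for the supremum of a continuous family. -/
lemma chevet_tail_sup {K P R T : Type*} [Fintype K] [Fintype P] [Fintype R] [TopologicalSpace T]
    [TopologicalSpace.SeparableSpace T] [Nonempty P] [Nonempty R] {a : T → K → ℝ}
    (hac : Continuous a) (u : T → P → ℝ) (w : T → R → ℝ) (hu : ∀ i, u i ⬝ᵥ u i = 1)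
    (hw : ∀ i, w i ⬝ᵥ w i = 1) (ha : ∀ i j, a i ⬝ᵥ a j = (u i ⬝ᵥ u j) * (w i ⬝ᵥ w j))
    {t : ℝ} (ht : 0 < t) :
    gaussianVec K {x | ∃ i, √(Fintype.card P : ℝ) + √(Fintype.card R : ℝ) + t < a i ⬝ᵥ x} ≤
      ENNReal.ofReal (Real.exp (-(t ^ 2 / 2))) := by
  rcases isEmpty_or_nonempty T with hT | hT
  · simp
  set s := √(Fintype.card P : ℝ) + √(Fintype.card R : ℝ) + t
  let D := TopologicalSpace.denseSeq T
  let E : ℕ → Set (K → ℝ) := fun N => {x | ∃ i : Fin N, s ≤ a (D i) ⬝ᵥ x}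
  have hE : Monotone E := by
    rintro N M hNM x ⟨i, hi⟩
    exact ⟨Fin.castLE hNM i, hi⟩
  have hsub : {x | ∃ i, s < a i ⬝ᵥ x} ⊆ ⋃ N, E N := by
    rintro x ⟨i, hi⟩
    have hopen : IsOpen {i | s < a i ⬝ᵥ x} := by
      refine isOpen_lt continuous_const ?_
      simp only [dotProduct]
      fun_prop
    obtain ⟨k, hk⟩ := (TopologicalSpace.denseRange_denseSeq T).exists_mem_open hopen ⟨i, hi⟩
    refine Set.mem_iUnion.2 ⟨k + 1, Fin.last k, ?_⟩
    have hk' : s < a (D k) ⬝ᵥ x := hk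
    simpa using hk'.le
  refine (measure_mono hsub).trans ?_
  rw [hE.measure_iUnion]
  exact iSup_le fun N => chevet_tail (fun i : Fin N => a (D i)) (fun i => u (D i))
    (fun i => w (D i)) (fun i => hu _) (fun i => hw _) (fun i j => ha _ _) ht

lemma map_uncurry_stdGaussian (ι κ : Type*) [Fintype ι] [Fintype κ] :
    (stdGaussian ι κ).map (fun W (q : ι × κ) => W q.1 q.2) = gaussianVec (ι × κ) := by
  refine (Measure.pi_eq fun s hs => ?_).symm
  rw [Measure.map_apply (by fun_prop) (MeasurableSet.univ_pi hs)]
  have : (fun W (q : ι × κ) => W q.1 q.2) ⁻¹' (Set.univ.pi s) =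
      Set.univ.pi fun i : ι => Set.univ.pi fun k : κ => s (i, k) := by
    ext W
    simp [Set.mem_pi]
  rw [this]
  simp only [stdGaussian, Measure.pi_pi, Fintype.prod_prod_type]

/-- Chevet's inequality in tail form: the bilinear form of a Gaussian matrix, restricted to the
images of two isometries. -/
lemma stdGaussian_bilin_tail {ι κ P R : Type*} [Fintype ι] [Fintype κ] [Fintype P] [Fintype R]
    [Nonempty P] [Nonempty R] {C : (P → ℝ) → ι → ℝ} {B : (R → ℝ) → κ → ℝ}
    (hCc : Continuous C) (hBc : Continuous B) (hC : ∀ u v, C u ⬝ᵥ C v = u ⬝ᵥ v)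
    (hB : ∀ u v, B u ⬝ᵥ B v = u ⬝ᵥ v) {t : ℝ} (ht : 0 < t) :
    stdGaussian ι κ {W | ∃ u w, u ⬝ᵥ u = 1 ∧ w ⬝ᵥ w = 1 ∧
      √(Fintype.card P : ℝ) + √(Fintype.card R : ℝ) + t < C u ⬝ᵥ (Matrix.of W *ᵥ B w)} ≤
      ENNReal.ofReal (Real.exp (-(t ^ 2 / 2))) := by
  let T := {q : (P → ℝ) × (R → ℝ) // q.1 ⬝ᵥ q.1 = 1 ∧ q.2 ⬝ᵥ q.2 = 1}
  let a : T → ι × κ → ℝ := fun q k => C q.1.1 k.1 * B q.1.2 k.2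
  have hac : Continuous a := by fun_prop
  have ha : ∀ i j : T, a i ⬝ᵥ a j = (i.1.1 ⬝ᵥ j.1.1) * (i.1.2 ⬝ᵥ j.1.2) := by
    intro i j
    rw [← hC, ← hB]
    simp only [a, dotProduct, Fintype.sum_prod_type, Finset.sum_mul_sum]
    refine Finset.sum_congr rfl fun _ _ => Finset.sum_congr rfl fun _ _ => by ring
  refine le_trans ?_ (chevet_tail_sup hac (fun q => q.1.1) (fun q => q.1.2) (fun q => q.2.1)
    (fun q => q.2.2) ha ht)
  rw [← map_uncurry_stdGaussian ι κ]
  refine (measure_mono ?_).trans (Measure.le_map_apply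
    (Measurable.aemeasurable (by fun_prop)) _)
  rintro W ⟨u, w, hu, hw, h⟩
  refine ⟨⟨(u, w), hu, hw⟩, h.trans_eq ?_⟩
  simp only [a, dotProduct, mulVec, Fintype.sum_prod_type, Finset.mul_sum, Matrix.of_apply]
  refine Finset.sum_congr rfl fun _ _ => Finset.sum_congr rfl fun _ _ => by ring

end ChevetSup

end GaussianComparison

section OpNorm

variable {α β : Type*} [Fintype α] [Fintype β]

lemma vnorm_sq (v : β → ℝ) : vnorm v ^ 2 = v ⬝ᵥ v := by
  rw [vnorm, Real.sq_sqrt (Finset.sum_nonneg fun _ _ => sq_nonneg _)]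
  simp [dotProduct, sq]

lemma vnorm_nonneg (v : β → ℝ) : 0 ≤ vnorm v := Real.sqrt_nonneg _

lemma vnorm_eq_one_iff {v : β → ℝ} : vnorm v = 1 ↔ v ⬝ᵥ v = 1 := by
  rw [← vnorm_sq, pow_eq_one_iff_of_nonneg (vnorm_nonneg v) two_ne_zero]

lemma dotProduct_le_vnorm_mul (u v : β → ℝ) : u ⬝ᵥ v ≤ vnorm u * vnorm v :=
  Real.sum_mul_le_sqrt_mul_sqrt Finset.univ u v

lemma vnorm_smul (c : ℝ) (v : β → ℝ) : vnorm (c • v) = |c| * vnorm v := by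
  simp only [vnorm, Pi.smul_apply, smul_eq_mul, mul_pow, ← Finset.mul_sum]
  rw [Real.sqrt_mul (sq_nonneg c), Real.sqrt_sq_eq_abs]

lemma vnorm_inv_smul_self {v : β → ℝ} (hv : 0 < vnorm v) : vnorm ((vnorm v)⁻¹ • v) = 1 := by
  rw [vnorm_smul, abs_of_pos (inv_pos.2 hv), inv_mul_cancel₀ hv.ne']

lemma vnorm_mulVec_le_frob (X : Matrix α β ℝ) {u : β → ℝ} (hu : vnorm u = 1) :
    vnorm (X *ᵥ u) ≤ frob X := by
  refine Real.sqrt_le_sqrt (Finset.sum_le_sum fun i _ => ?_)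
  have h := Finset.sum_mul_sq_le_sq_mul_sq Finset.univ (X i) u
  have hu' : ∑ j, u j ^ 2 = 1 := by
    rw [← vnorm_eq_one_iff.1 hu]
    simp [dotProduct, sq]
  rwa [hu', mul_one] at h

lemma vnorm_mulVec_le_opNorm (X : Matrix α β ℝ) {u : β → ℝ} (hu : vnorm u = 1) :
    vnorm (X *ᵥ u) ≤ opNorm X := by
  refine le_csSup ⟨frob X, ?_⟩ ⟨u, hu, rfl⟩
  rintro _ ⟨v, hv, rfl⟩
  exact vnorm_mulVec_le_frob X hv

lemma opNorm_nonneg (X : Matrix α β ℝ) : 0 ≤ opNorm X := by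
  refine Real.sSup_nonneg ?_
  rintro _ ⟨v, _, rfl⟩
  exact vnorm_nonneg _

lemma opNorm_le {X : Matrix α β ℝ} {b : ℝ} (hb : 0 ≤ b)
    (h : ∀ u, vnorm u = 1 → vnorm (X *ᵥ u) ≤ b) : opNorm X ≤ b := by
  refine Real.sSup_le ?_ hb
  rintro _ ⟨v, hv, rfl⟩
  exact h v hv

lemma vnorm_le_of_dotProduct_le {v : β → ℝ} {b : ℝ} (hb : 0 ≤ b)
    (h : ∀ w, w ⬝ᵥ w = 1 → w ⬝ᵥ v ≤ b) : vnorm v ≤ b := by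
  rcases (vnorm_nonneg v).eq_or_lt with h0 | h0
  · rwa [← h0]
  have h1 := h _ (vnorm_eq_one_iff.1 (vnorm_inv_smul_self h0))
  rwa [smul_dotProduct, ← vnorm_sq, smul_eq_mul, sq, inv_mul_cancel_left₀ h0.ne'] at h1

lemma opNorm_le_of_bilin_le {X : Matrix α β ℝ} {b : ℝ} (hb : 0 ≤ b)
    (h : ∀ u w, u ⬝ᵥ u = 1 → w ⬝ᵥ w = 1 → u ⬝ᵥ (X *ᵥ w) ≤ b) : opNorm X ≤ b :=
  opNorm_le hb fun w hw => vnorm_le_of_dotProduct_le hb fun u hu =>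
    h u w hu (vnorm_eq_one_iff.1 hw)

lemma vnorm_transpose_mulVec_le_opNorm (A : Matrix α β ℝ) {v : α → ℝ} (hv : vnorm v = 1) :
    vnorm (Aᵀ *ᵥ v) ≤ opNorm A := by
  refine vnorm_le_of_dotProduct_le (opNorm_nonneg A) fun w hw => ?_
  rw [mulVec_transpose, dotProduct_comm, ← dotProduct_mulVec]
  refine (dotProduct_le_vnorm_mul _ _).trans ?_
  rw [hv, one_mul]
  exact vnorm_mulVec_le_opNorm A (vnorm_eq_one_iff.2 hw)

lemma opNorm_mask_le {n d m : ℕ} (W : Matrix (Fin n × Fin d) (Fin m) ℝ) (i : Fin n) :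
    opNorm (mask W i) ≤ opNorm W := by
  refine opNorm_le (opNorm_nonneg W) fun u hu => le_trans ?_ (vnorm_mulVec_le_opNorm W hu)
  refine Real.sqrt_le_sqrt (Finset.sum_le_sum fun p _ => ?_)
  by_cases hp : p.1 = i
  · have : (mask W i *ᵥ u) p = 0 := by simp [mask, mulVec, dotProduct, hp]
    rw [this, zero_pow two_ne_zero]
    exact sq_nonneg _
  · have : (mask W i *ᵥ u) p = (W *ᵥ u) p := by simp [mask, mulVec, dotProduct, hp]
    rw [this]

/-- If the bilinear form of `X` is bounded by `b` over unit vectors of the row space of `A`, then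
the operator norm of `X * Aᵀ` is at most `b * opNorm A`. -/
lemma opNorm_mul_transpose_le {δ : Type*} [Fintype δ] {X : Matrix δ β ℝ} {A : Matrix α β ℝ} {b : ℝ}
    (hb : 0 ≤ b) (h : ∀ u v, u ⬝ᵥ u = 1 → (Aᵀ *ᵥ v) ⬝ᵥ (Aᵀ *ᵥ v) = 1 →
      u ⬝ᵥ (X *ᵥ (Aᵀ *ᵥ v)) ≤ b) : opNorm (X * Aᵀ) ≤ b * opNorm A := by
  refine opNorm_le (mul_nonneg hb (opNorm_nonneg A)) fun v hv => ?_
  refine vnorm_le_of_dotProduct_le (mul_nonneg hb (opNorm_nonneg A)) fun u hu => ?_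
  refine le_trans ?_ (mul_le_mul_of_nonneg_left (vnorm_transpose_mulVec_le_opNorm A hv) hb)
  set y := Aᵀ *ᵥ v with hy
  rw [← mulVec_mulVec, ← hy]
  rcases (vnorm_nonneg y).eq_or_lt with h0 | h0
  · have : y = 0 := by
      rw [← dotProduct_self_eq_zero, ← vnorm_sq, ← h0]
      simp
    rw [this, mulVec_zero, dotProduct_zero]
    exact mul_nonneg hb (vnorm_nonneg _)
  have h1 := h u ((vnorm y)⁻¹ • v) hu (by
    rw [mulVec_smul]
    exact vnorm_eq_one_iff.1 (vnorm_inv_smul_self h0))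
  rwa [mulVec_smul, ← hy, mulVec_smul, dotProduct_smul, smul_eq_mul, inv_mul_le_iff₀ h0,
    mul_comm] at h1

lemma inner_eq_ofLp_dotProduct (x y : EuclideanSpace ℝ β) :
    inner ℝ x y = x.ofLp ⬝ᵥ y.ofLp := by
  simp [EuclideanSpace.inner_eq_star_dotProduct, dotProduct_comm]

/-- Isometric parametrization of the row space of a matrix. -/
lemma exists_isometry_rowSpace (A : Matrix α β ℝ) :
    ∃ (r : ℕ) (B : (Fin r → ℝ) → β → ℝ), r ≤ Fintype.card α ∧ Continuous B ∧
      (∀ u v, B u ⬝ᵥ B v = u ⬝ᵥ v) ∧ ∀ v, ∃ w, B w = Aᵀ *ᵥ v := by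
  classical
  let S := LinearMap.range (Matrix.toEuclideanLin Aᵀ)
  let e := stdOrthonormalBasis ℝ S
  refine ⟨Module.finrank ℝ S,
    fun u => ((e.repr.symm (WithLp.toLp 2 u) : S) : EuclideanSpace ℝ β).ofLp, ?_, ?_, ?_, ?_⟩
  · simpa using LinearMap.finrank_range_le (Matrix.toEuclideanLin Aᵀ)
  · fun_prop
  · intro u v
    rw [← inner_eq_ofLp_dotProduct, ← Submodule.coe_inner, LinearIsometryEquiv.inner_map_map, inner_eq_ofLp_dotProduct]
  · intro v
    refine ⟨(e.repr ⟨Matrix.toEuclideanLin Aᵀ (WithLp.toLp 2 v),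
      LinearMap.mem_range_self _ _⟩).ofLp, ?_⟩
    simp

end OpNorm

section BlockTails

lemma stdGaussian_opNorm_tail {ι κ : Type*} [Fintype ι] [Fintype κ] [Nonempty ι] [Nonempty κ]
    {t : ℝ} (ht : 0 < t) :
    stdGaussian ι κ {W | √(Fintype.card ι : ℝ) + √(Fintype.card κ : ℝ) + t <
      opNorm (Matrix.of W)} ≤ ENNReal.ofReal (Real.exp (-(t ^ 2 / 2))) := by
  refine (measure_mono ?_).trans (stdGaussian_bilin_tail (ι := ι) (κ := κ) continuous_id
    continuous_id (fun _ _ => rfl) (fun _ _ => rfl) ht)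
  intro W hW
  by_contra hcon
  refine absurd (opNorm_le_of_bilin_le (by positivity) fun u w hu hw => ?_) (not_le.2 hW)
  by_contra h
  exact hcon ⟨u, w, hu, hw, not_le.1 h⟩

variable {n d m : ℕ}

/-- Extension by zero of a vector supported on the `i`-th block. -/
def blockVec (i : Fin n) (u : Fin d → ℝ) (p : Fin n × Fin d) : ℝ :=
  if p.1 = i then u p.2 else 0

lemma continuous_blockVec (i : Fin n) : Continuous (blockVec (d := d) i) := by
  refine continuous_pi fun p => ?_
  by_cases h : p.1 = i
  · simp only [blockVec, h, if_true]
    fun_prop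
  · simp only [blockVec, h, if_false]
    fun_prop

lemma blockVec_dotProduct (i : Fin n) (u : Fin d → ℝ) (x : Fin n × Fin d → ℝ) :
    blockVec i u ⬝ᵥ x = u ⬝ᵥ fun a => x (i, a) := by
  simp only [blockVec, dotProduct, Fintype.sum_prod_type_right, ite_mul, zero_mul]
  simp

lemma blockVec_dotProduct_blockVec (i : Fin n) (u v : Fin d → ℝ) :
    blockVec i u ⬝ᵥ blockVec i v = u ⬝ᵥ v := by
  rw [blockVec_dotProduct]
  simp [blockVec]

lemma stdGaussian_blk_bilin_tail [NeZero d] {r : ℕ} [NeZero r] {B : (Fin r → ℝ) → Fin m → ℝ}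
    (hBc : Continuous B) (hB : ∀ u v, B u ⬝ᵥ B v = u ⬝ᵥ v) (i : Fin n) {t : ℝ} (ht : 0 < t) :
    stdGaussian (Fin n × Fin d) (Fin m) {W | ∃ u w, u ⬝ᵥ u = 1 ∧ w ⬝ᵥ w = 1 ∧
      √(d : ℝ) + √(r : ℝ) + t < u ⬝ᵥ (blk (Matrix.of W) i *ᵥ B w)} ≤
      ENNReal.ofReal (Real.exp (-(t ^ 2 / 2))) := by
  refine (measure_mono ?_).trans (stdGaussian_bilin_tail (continuous_blockVec (d := d) i) hBc
    (blockVec_dotProduct_blockVec i) hB ht)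
  rintro W ⟨u, w, hu, hw, h⟩
  refine ⟨u, w, hu, hw, ?_⟩
  rw [blockVec_dotProduct, Fintype.card_fin, Fintype.card_fin]
  exact h

lemma stdGaussian_opNorm_blk_tail [NeZero d] [NeZero m] (i : Fin n) {t : ℝ} (ht : 0 < t) :
    stdGaussian (Fin n × Fin d) (Fin m)
      {W | √(d : ℝ) + √(m : ℝ) + t < opNorm (blk (Matrix.of W) i)} ≤
      ENNReal.ofReal (Real.exp (-(t ^ 2 / 2))) := by
  refine (measure_mono ?_).trans (stdGaussian_blk_bilin_tail (d := d) (B := fun w => w)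
    continuous_id (fun _ _ => rfl) i ht)
  intro W hW
  by_contra hcon
  refine absurd (opNorm_le_of_bilin_le (by positivity) fun u w hu hw => ?_) (not_le.2 hW)
  by_contra h
  exact hcon ⟨u, w, hu, hw, not_le.1 h⟩

lemma stdGaussian_opNorm_blk_mul_transpose_tail [NeZero d] (A : Matrix (Fin d) (Fin m) ℝ)
    (i : Fin n) {t : ℝ} (ht : 0 < t) :
    stdGaussian (Fin n × Fin d) (Fin m)
      {W | (2 * √(d : ℝ) + t) * opNorm A < opNorm (blk (Matrix.of W) i * Aᵀ)} ≤
      ENNReal.ofReal (Real.exp (-(t ^ 2 / 2))) := by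
  obtain ⟨r, B, hr, hBc, hB, hBA⟩ := exists_isometry_rowSpace A
  rw [Fintype.card_fin] at hr
  have hrd : √(r : ℝ) ≤ √(d : ℝ) := Real.sqrt_le_sqrt (by exact_mod_cast hr)
  have hsub : {W : Fin n × Fin d → Fin m → ℝ | (2 * √(d : ℝ) + t) * opNorm A < opNorm (blk (Matrix.of W) i * Aᵀ)} ⊆
      {W | ∃ u w, u ⬝ᵥ u = 1 ∧ w ⬝ᵥ w = 1 ∧
        √(d : ℝ) + √(r : ℝ) + t < u ⬝ᵥ (blk (Matrix.of W) i *ᵥ B w)} := by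
    intro W hW
    by_contra hcon
    refine absurd (opNorm_mul_transpose_le (by positivity) fun u v hu hv => ?_) (not_le.2 hW)
    by_contra h
    obtain ⟨w, hw⟩ := hBA v
    rw [← hw] at hv h
    exact hcon ⟨u, w, hu, (hB w w).symm.trans hv, by linarith⟩
  refine (measure_mono hsub).trans ?_
  rcases Nat.eq_zero_or_pos r with rfl | hr0
  · simp
  · have : NeZero r := ⟨hr0.ne'⟩
    exact stdGaussian_blk_bilin_tail hBc hB i ht

end BlockTails

/-- Gaussian norm bounds (5.13a)–(5.13d): with probability at least
1 − 10n^{−γ+1}, the operator norms of W_i, W, W^(i) and W_iAᵀ are all controlled. -/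
theorem gaussian_norm_bounds (n d m : ℕ) (hn : 1 ≤ n) (hd : 1 ≤ d) (hm : d ≤ m)
    (γ : ℝ) (hγ : 1 < γ) (A : Matrix (Fin d) (Fin m) ℝ) :
    ENNReal.ofReal (1 - 10 * (n : ℝ) ^ (-γ + 1)) ≤
      stdGaussian (Fin n × Fin d) (Fin m) {W |
        (∀ i, opNorm (blk (Matrix.of W) i) ≤
          Real.sqrt (d : ℝ) + Real.sqrt (m : ℝ) + Real.sqrt (2 * γ * Real.log n)) ∧
        opNorm (Matrix.of W) ≤ bnd2 n d m γ ∧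
        (∀ i, opNorm (mask (Matrix.of W) i) ≤ bnd2 n d m γ) ∧
        (∀ i, opNorm (blk (Matrix.of W) i * Aᵀ) ≤
          (2 * Real.sqrt (d : ℝ) + Real.sqrt (2 * γ * Real.log n)) * opNorm A)} := by
  rcases hn.eq_or_lt with rfl | hn2
  · rw [ENNReal.ofReal_of_nonpos (by norm_num)]
    exact zero_le
  have : NeZero d := ⟨by omega⟩
  have : NeZero m := ⟨by omega⟩
  have : NeZero n := ⟨by omega⟩
  have hlog : 0 < Real.log n := Real.log_pos (by exact_mod_cast hn2)
  have hn0 : (0 : ℝ) < n := by positivity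
  set t := √(2 * γ * Real.log n) with ht_def
  have ht : 0 < t := Real.sqrt_pos.2 (by positivity)
  have htail : Real.exp (-(t ^ 2 / 2)) = (n : ℝ) ^ (-γ) := by
    rw [ht_def, Real.sq_sqrt (by positivity), Real.rpow_def_of_pos hn0]
    congr 1
    ring
  have hb : bnd2 n d m γ =
      √(Fintype.card (Fin n × Fin d) : ℝ) + √(Fintype.card (Fin m) : ℝ) + t := by
    simp [bnd2, ht_def]
  set ν := stdGaussian (Fin n × Fin d) (Fin m) with hν
  have hprob : IsProbabilityMeasure ν := by
    rw [hν, stdGaussian]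
    infer_instance
  set E := {W : Fin n × Fin d → Fin m → ℝ | _} with hE
  set E1 : Fin n → Set (Fin n × Fin d → Fin m → ℝ) := fun i =>
    {W | √(d : ℝ) + √(m : ℝ) + t < opNorm (blk (Matrix.of W) i)}
  set E2 : Set (Fin n × Fin d → Fin m → ℝ) := {W |
    √(Fintype.card (Fin n × Fin d) : ℝ) + √(Fintype.card (Fin m) : ℝ) + t < opNorm (Matrix.of W)}
  set E3 : Fin n → Set (Fin n × Fin d → Fin m → ℝ) := fun i =>
    {W | (2 * √(d : ℝ) + t) * opNorm A < opNorm (blk (Matrix.of W) i * Aᵀ)}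
  set δ := ENNReal.ofReal (Real.exp (-(t ^ 2 / 2))) with hδ
  have h1 : ∀ i, ν (E1 i) ≤ δ := fun i => stdGaussian_opNorm_blk_tail i ht
  have h2 : ν E2 ≤ δ := stdGaussian_opNorm_tail ht
  have h3 : ∀ i, ν (E3 i) ≤ δ := fun i => stdGaussian_opNorm_blk_mul_transpose_tail A i ht
  have hcover : Set.univ ⊆ E ∪ ((⋃ i, E1 i) ∪ E2 ∪ ⋃ i, E3 i) := by
    intro W _
    by_contra hcon
    simp only [Set.mem_union, Set.mem_iUnion, not_or, not_exists] at hcon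
    obtain ⟨hW, ⟨hW1, hW2⟩, hW3⟩ := hcon
    have hW2' : opNorm (Matrix.of W) ≤ bnd2 n d m γ := hb ▸ not_lt.1 hW2
    exact hW ⟨fun i => not_lt.1 (hW1 i), hW2', fun i => (opNorm_mask_le _ i).trans hW2',
      fun i => not_lt.1 (hW3 i)⟩
  have hsum : (1 : ENNReal) ≤ ν E + (n * δ + δ + n * δ) := by
    have hU : ∀ {F : Fin n → Set (Fin n × Fin d → Fin m → ℝ)}, (∀ i, ν (F i) ≤ δ) →
        ν (⋃ i, F i) ≤ n * δ := fun {F} hF => by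
      refine (measure_iUnion_fintype_le ν F).trans ?_
      simpa using Finset.sum_le_sum fun i (_ : i ∈ Finset.univ) => hF i
    calc (1 : ENNReal) = ν Set.univ := measure_univ.symm
      _ ≤ ν (E ∪ ((⋃ i, E1 i) ∪ E2 ∪ ⋃ i, E3 i)) := measure_mono hcover
      _ ≤ ν E + ν ((⋃ i, E1 i) ∪ E2 ∪ ⋃ i, E3 i) := measure_union_le _ _
      _ ≤ ν E + (ν ((⋃ i, E1 i) ∪ E2) + ν (⋃ i, E3 i)) := by gcongr; exact measure_union_le _ _
      _ ≤ ν E + (ν (⋃ i, E1 i) + ν E2 + ν (⋃ i, E3 i)) := by gcongr; exact measure_union_le _ _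
      _ ≤ _ := by gcongr; exacts [hU h1, hU h3]
  have hδn : n * δ + δ + n * δ = ENNReal.ofReal ((2 * n + 1) * (n : ℝ) ^ (-γ)) := by
    rw [hδ, htail, ← ENNReal.ofReal_natCast, ← ENNReal.ofReal_mul (by positivity),
      ← ENNReal.ofReal_add (by positivity) (by positivity),
      ← ENNReal.ofReal_add (by positivity) (by positivity)]
    congr 1
    ring
  rw [hδn] at hsum
  have hle : (2 * n + 1) * (n : ℝ) ^ (-γ) ≤ 10 * (n : ℝ) ^ (-γ + 1) := by
    rw [Real.rpow_add_one hn0.ne']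
    have h1n : (1 : ℝ) ≤ n := by exact_mod_cast hn
    have hpos : 0 < (n : ℝ) ^ (-γ) := by positivity
    nlinarith
  rw [ENNReal.ofReal_sub _ (by positivity), ENNReal.ofReal_one, tsub_le_iff_right]
  exact hsum.trans (by gcongr)

end GOPP
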